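/- arXiv:2201.05656 — 2 statements merged into one kernel-verified Lean document; each statement's English description precedes it below -/
import Mathlib

section
/- Fix t > 1 and suppose that σ is an S-free admissible word such that every intermediate word between σ and ση (inclusive) has weight w < 1, where η is a word with ση admissible. Then ση is S-free. -/
open Filter MeasureTheory
open scoped BigOperators

namespace SFT

/-- A finite word `x_1 ⋯ x_m` is admissible if the `(x_{j+1}, x_j)` entry of `T`
equals `1` for all `1 ≤ j < m`. -/
def Admissible {n : ℕ} (T : Matrix (Fin n) (Fin n) ℝ) (w : List (Fin n)) : Prop :=
  w.Chain' fun a b => T b a = 1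

/-- The subshift of finite type `Σ` determined by `T`: bi-infinite sequences with
all transitions allowed. -/
def SFTspace {n : ℕ} (T : Matrix (Fin n) (Fin n) ℝ) : Set (ℤ → Fin n) :=
  {x | ∀ i : ℤ, T (x (i + 1)) (x i) = 1}

/-- The word `w` occurs in the bi-infinite sequence `x` starting at coordinate `a`. -/
def OccursAt {A : Type*} (w : List A) (x : ℤ → A) (a : ℤ) : Prop :=
  ∀ (j : ℕ) (h : j < w.length), x (a + j) = w.get ⟨j, h⟩

/-- The word `w` occurs somewhere in the bi-infinite sequence `x`. -/
def Occurs {A : Type*} (w : List A) (x : ℤ → A) : Prop :=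
  ∃ a : ℤ, OccursAt w x a

/-- `N_X(m)`: the number of words of length `m` occurring in elements of `X`. -/
noncomputable def wordCount {A : Type*} (X : Set (ℤ → A)) (m : ℕ) : ℕ :=
  {w : List A | w.length = m ∧ ∃ x ∈ X, Occurs w x}.ncard

/-- The entropy `h(X) = lim_{m→∞} (1/m) log N_X(m)` of a subshift (for subshifts the
limit exists, hence coincides with the limsup used here). -/
noncomputable def entropy {A : Type*} (X : Set (ℤ → A)) : ℝ :=
  Filter.atTop.limsup fun m : ℕ => Real.log (wordCount X m) / m

/-- `Σ⟨S⟩`: the elements of `Σ` in which no word of `S` occurs. -/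
def Avoid {n : ℕ} (T : Matrix (Fin n) (Fin n) ℝ) (S : Finset (List (Fin n))) :
    Set (ℤ → Fin n) :=
  {x ∈ SFTspace T | ∀ τ ∈ S, ¬ Occurs τ x}

/-- `p(t) = ∑_{τ ∈ S} t^{|τ|}`. -/
noncomputable def wordPoly {n : ℕ} (S : Finset (List (Fin n))) (t : ℝ) : ℝ :=
  ∑ τ ∈ S, t ^ τ.length

/-- The cylinder set `[σ]` (inside `Σ`), with `σ` beginning at coordinate `0`.
It is empty when `σ` is not admissible. -/
def cylinder {n : ℕ} (T : Matrix (Fin n) (Fin n) ℝ) (σ : List (Fin n)) :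
    Set (ℤ → Fin n) :=
  {x ∈ SFTspace T | OccursAt σ x 0}

/-- `N(σ, k)`: the number of words `η` of length `k` such that `ση` is admissible. -/
noncomputable def extCount {n : ℕ} (T : Matrix (Fin n) (Fin n) ℝ) (σ : List (Fin n))
    (k : ℕ) : ℕ :=
  {η : List (Fin n) | η.length = k ∧ Admissible T (σ ++ η)}.ncard

/-- A word is `S`-free if no element of `S` occurs in it as a consecutive subword. -/
def SFree {A : Type*} (S : Finset (List A)) (w : List A) : Prop :=
  ∀ τ ∈ S, ¬ τ <:+: w

open Classical in
/-- `f_σ(α) = ∑_{τ ∈ S} ∑_j t^j`, the inner sum over integers `j ≥ 0` such that `τ`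
occurs in `α` beginning within `σ` (placed at coordinate `0`) and ending `j` symbols
beyond the end of `σ`. -/
noncomputable def fword {n : ℕ} (S : Finset (List (Fin n))) (t : ℝ) (σ : List (Fin n))
    (x : ℤ → Fin n) : ℝ :=
  ∑ τ ∈ S, ∑ j ∈ Finset.range τ.length,
    if τ.length ≤ σ.length + j ∧ OccursAt τ x ((σ.length : ℤ) + j - τ.length)
    then t ^ j else 0

/-- The weight `w(σ) = (1/μ([σ])) ∫_{[σ]} f_σ dμ`. -/
noncomputable def weight {n : ℕ} (T : Matrix (Fin n) (Fin n) ℝ)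
    (μ : Measure (ℤ → Fin n)) (S : Finset (List (Fin n))) (t : ℝ)
    (σ : List (Fin n)) : ℝ :=
  (∫ x in cylinder T σ, fword S t σ x ∂μ) / (μ (cylinder T σ)).toReal

/-- `p_σ = ∑_{τ ∈ S} (μ([στ])/μ([σ])) t^{|τ|}`. -/
noncomputable def pWord {n : ℕ} (T : Matrix (Fin n) (Fin n) ℝ)
    (μ : Measure (ℤ → Fin n)) (S : Finset (List (Fin n))) (t : ℝ)
    (σ : List (Fin n)) : ℝ :=
  ∑ τ ∈ S, (μ (cylinder T (σ ++ τ))).toReal / (μ (cylinder T σ)).toReal * t ^ τ.length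

/-- `S_{σ,j}`: the subset of `[σ]` of elements containing some `τ ∈ S` that begins
within `σ` and ends `j` symbols after the end of `σ`. -/
def Ssub {n : ℕ} (T : Matrix (Fin n) (Fin n) ℝ) (S : Finset (List (Fin n)))
    (σ : List (Fin n)) (j : ℕ) : Set (ℤ → Fin n) :=
  {x ∈ cylinder T σ | ∃ τ ∈ S, τ.length ≤ σ.length + j ∧ j < τ.length ∧
    OccursAt τ x ((σ.length : ℤ) + j - τ.length)}

/-- `η` is a good extension of an `S`-free word `σ`: `ση` is admissible and every
intermediate word between `σ` and `ση` (inclusive) has weight `< 1`. -/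
def GoodExt {n : ℕ} (T : Matrix (Fin n) (Fin n) ℝ) (μ : Measure (ℤ → Fin n))
    (S : Finset (List (Fin n))) (t : ℝ) (σ η : List (Fin n)) : Prop :=
  Admissible T (σ ++ η) ∧ ∀ η', η' <+: η → weight T μ S t (σ ++ η') < 1

/-- `G(σ, m)`: union of the cylinder sets `[ση]` over good `η` of length `m`. -/
def GSet {n : ℕ} (T : Matrix (Fin n) (Fin n) ℝ) (μ : Measure (ℤ → Fin n))
    (S : Finset (List (Fin n))) (t : ℝ) (σ : List (Fin n)) (m : ℕ) :
    Set (ℤ → Fin n) :=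
  ⋃ η ∈ {η : List (Fin n) | η.length = m ∧ GoodExt T μ S t σ η}, cylinder T (σ ++ η)

/-- The alphabet of `Σ_k`: admissible words of length `k` in `Σ`. -/
def BlockAlphabet {n : ℕ} (T : Matrix (Fin n) (Fin n) ℝ) (k : ℕ) :=
  {w : List (Fin n) // w.length = k ∧ Admissible T w}

/-- `Σ_k`: the SFT on admissible `k`-blocks, where `[x_1⋯x_k][y_1⋯y_k]` is an
allowed transition iff `x_k y_1` is admissible in `Σ`. -/
def SigmaBlock {n : ℕ} [NeZero n] (T : Matrix (Fin n) (Fin n) ℝ) (k : ℕ) :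
    Set (ℤ → BlockAlphabet T k) :=
  {y | ∀ i : ℤ, T ((y (i + 1)).val.head!) ((y i).val.getLast!) = 1}

/-- The natural block-concatenation map `Σ_k → Σ`. -/
def blockConcat {n : ℕ} [NeZero n] (T : Matrix (Fin n) (Fin n) ℝ) (k : ℕ)
    (y : ℤ → BlockAlphabet T k) : ℤ → Fin n :=
  fun m => (y (Int.fdiv m k)).val.getD (Int.fmod m k).toNat default


theorem measurableSet_occursAt {n : ℕ} (w : List (Fin n)) (a : ℤ) :
    MeasurableSet {x : ℤ → Fin n | OccursAt w x a} := by
  have h : {x : ℤ → Fin n | OccursAt w x a} =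
      ⋂ (j : ℕ) (h : j < w.length), (fun x : ℤ → Fin n => x (a + j)) ⁻¹' {w.get ⟨j, h⟩} := by
    ext x
    simp [OccursAt]
  rw [h]
  exact MeasurableSet.iInter fun j => MeasurableSet.iInter fun _ =>
    measurable_pi_apply _ (MeasurableSet.singleton _)

theorem measurableSet_SFTspace {n : ℕ} (T : Matrix (Fin n) (Fin n) ℝ) :
    MeasurableSet (SFTspace T) := by
  have h : SFTspace T = ⋂ i : ℤ, (fun x : ℤ → Fin n => (x (i + 1), x i)) ⁻¹'
      {p | T p.1 p.2 = 1} := by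
    ext x
    simp [SFTspace]
  rw [h]
  exact MeasurableSet.iInter fun i =>
    ((measurable_pi_apply _).prodMk (measurable_pi_apply _)) (Set.toFinite _).measurableSet

theorem measurableSet_cylinder {n : ℕ} (T : Matrix (Fin n) (Fin n) ℝ) (σ : List (Fin n)) :
    MeasurableSet (cylinder T σ) :=
  (measurableSet_SFTspace T).inter (measurableSet_occursAt σ 0)

theorem integrable_fword {n : ℕ} (μ : Measure (ℤ → Fin n)) [IsFiniteMeasure μ]
    (S : Finset (List (Fin n))) (t : ℝ) (σ : List (Fin n)) :
    Integrable (fword S t σ) μ := by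
  classical
  unfold fword
  refine integrable_finsetSum _ fun τ _ => integrable_finsetSum _ fun j _ => ?_
  have hs : MeasurableSet {x : ℤ → Fin n | τ.length ≤ σ.length + j ∧
      OccursAt τ x ((σ.length : ℤ) + j - τ.length)} :=
    (MeasurableSet.const _).inter (measurableSet_occursAt _ _)
  refine ((integrable_const (μ := μ) (t ^ j)).indicator hs).congr (ae_of_all _ fun x => ?_)
  simp only [Set.indicator_apply, Set.mem_ofPred_eq]

theorem OccursAt.of_append {A : Type*} {w w' : List A} {x : ℤ → A} {a : ℤ}
    (h : OccursAt (w ++ w') x a) : OccursAt w' x (a + w.length) := by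
  intro j hj
  have := h (w.length + j) (by simp; omega)
  simpa [add_assoc] using this

theorem one_le_fword {n : ℕ} {S : Finset (List (Fin n))} {t : ℝ} (ht : 0 ≤ t)
    {τ : List (Fin n)} (hτ : τ ∈ S) (hne : τ ≠ []) {a : List (Fin n)} {x : ℤ → Fin n}
    (hx : OccursAt (a ++ τ) x 0) : 1 ≤ fword S t (a ++ τ) x := by
  classical
  have hnn : ∀ ρ ∈ S, ∀ j ∈ Finset.range ρ.length,
      0 ≤ if ρ.length ≤ (a ++ τ).length + j ∧
        OccursAt ρ x (((a ++ τ).length : ℤ) + j - ρ.length) then t ^ j else 0 := by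
    intro ρ _ j _
    split_ifs <;> positivity
  unfold fword
  refine le_trans ?_ (Finset.single_le_sum (fun ρ hρ => Finset.sum_nonneg (hnn ρ hρ)) hτ)
  refine le_trans ?_ (Finset.single_le_sum (hnn τ hτ)
    (Finset.mem_range.2 (List.length_pos_of_ne_nil hne)))
  have hx' := hx.of_append
  rw [if_pos]
  · simp
  · refine ⟨by simp, ?_⟩
    simpa using hx'

theorem one_le_weight {n : ℕ} (T : Matrix (Fin n) (Fin n) ℝ) (μ : Measure (ℤ → Fin n))
    [IsFiniteMeasure μ] {S : Finset (List (Fin n))} {t : ℝ} (ht : 0 ≤ t)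
    {τ : List (Fin n)} (hτ : τ ∈ S) (hne : τ ≠ []) {a : List (Fin n)}
    (hpos : μ (cylinder T (a ++ τ)) ≠ 0) : 1 ≤ weight T μ S t (a ++ τ) := by
  have hpos' : 0 < (μ (cylinder T (a ++ τ))).toReal :=
    ENNReal.toReal_pos hpos (measure_ne_top _ _)
  rw [weight, one_le_div hpos']
  have h := setIntegral_mono_on (μ := μ) (s := cylinder T (a ++ τ))
    (integrable_const (1 : ℝ)).integrableOn (integrable_fword μ S t (a ++ τ)).integrableOn
    (measurableSet_cylinder T _) fun x hx => one_le_fword ht hτ hne hx.2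
  simpa [Measure.real] using h

/-- If `σ` is `S`-free, `ση` is admissible, and every intermediate word between `σ`
and `ση` (inclusive) has weight `< 1`, then `ση` is `S`-free. -/
theorem good_extension_SFree
    {n : ℕ} [NeZero n] (T : Matrix (Fin n) (Fin n) ℝ) (lam : ℝ) (u v : Fin n → ℝ)
    (μ : Measure (ℤ → Fin n))
    (hT01 : ∀ i j, T i j = 0 ∨ T i j = 1)
    (hirr : ∀ i j : Fin n, ∃ m : ℕ, 0 < m ∧ 0 < (T ^ m) i j)
    (hlam : 1 < lam)
    (hu : ∀ i, 0 < u i) (hv : ∀ i, 0 < v i)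
    (huT : Matrix.vecMul u T = lam • u)
    (hTv : T.mulVec v = lam • v)
    (huv : ∑ i, u i * v i = 1)
    (hprob : IsProbabilityMeasure μ)
    (hinv : MeasurePreserving (fun (x : ℤ → Fin n) (i : ℤ) => x (i + 1)) μ μ)
    (hcyl : ∀ σ : List (Fin n), σ ≠ [] → Admissible T σ →
      μ (cylinder T σ) = ENNReal.ofReal (u σ.head! * v σ.getLast! / lam ^ (σ.length - 1)))
    (S : Finset (List (Fin n)))
    (hSne : ∀ τ ∈ S, τ ≠ [])
    (hSadm : ∀ τ ∈ S, Admissible T τ)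
    (hSanti : ∀ τ ∈ S, ∀ τ' ∈ S, τ ≠ τ' → ¬ τ <:+: τ')
    (t : ℝ) (ht : 1 < t)
    (σ η : List (Fin n)) (hσ : Admissible T σ) (hσfree : SFree S σ)
    (hadm : Admissible T (σ ++ η))
    (hw : ∀ η', η' <+: η → weight T μ S t (σ ++ η') < 1) :
    SFree S (σ ++ η) := by
  rintro τ hτ ⟨a, b, hab⟩
  have hne := hSne τ hτ
  have hpre : a ++ τ <+: σ ++ η := ⟨b, hab⟩
  rcases List.prefix_or_prefix_of_prefix hpre (List.prefix_append σ η) with h | ⟨η', h⟩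
  · exact hσfree τ hτ ((List.suffix_append a τ).isInfix.trans h.isInfix)
  · have hη' : η' <+: η := by
      rwa [← h, List.prefix_append_right_inj] at hpre
    have hadm' : Admissible T (a ++ τ) := List.IsChain.prefix hadm hpre
    have hpos : μ (cylinder T (a ++ τ)) ≠ 0 := by
      rw [hcyl _ (by simp [hne]) hadm', ne_eq, ENNReal.ofReal_eq_zero, not_le]
      have := hu (a ++ τ).head!
      have := hv (a ++ τ).getLast!
      positivity
    have hlt := hw η' hη'
    rw [h] at hlt
    exact absurd (one_le_weight T μ (by linarith) hτ hne hpos) (not_le.2 hlt)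

end SFT
end

section
/- Suppose there exists t > 1 with r = (1 + D·A^{−1}·p(t/λ))/t < 1. Then h(Σ) − h(Σ⟨S⟩) < −log(1 − r). -/
open Filter MeasureTheory
open scoped BigOperators

namespace SFT

open Classical in
/-- The admissible `S`-free words of length `m`. -/
noncomputable def freeWords {n : ℕ} (T : Matrix (Fin n) (Fin n) ℝ)
    (S : Finset (List (Fin n))) (m : ℕ) : Finset (List (Fin n)) :=
  (List.finite_length_eq (Fin n) m).toFinset.filter fun w => Admissible T w ∧ SFree S w

/-- The weight `v a` of a word with first letter `a`; the empty word gets `(∑ i, v i) / lam`, so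
that the weights of the admissible left extensions of a word always add up to `lam` times
its weight. -/
noncomputable def headWeight {n : ℕ} (lam : ℝ) (v : Fin n → ℝ) : List (Fin n) → ℝ
  | [] => (∑ i, v i) / lam
  | a :: _ => v a

open Classical in
/-- The admissible words of length `m + 1` whose tail is `S`-free. -/
noncomputable def extWords {n : ℕ} (T : Matrix (Fin n) (Fin n) ℝ)
    (S : Finset (List (Fin n))) (m : ℕ) : Finset (List (Fin n)) :=
  (List.finite_length_eq (Fin n) (m + 1)).toFinset.filter fun w =>
    Admissible T w ∧ SFree S w.tail

section Words

variable {n : ℕ} {T : Matrix (Fin n) (Fin n) ℝ} {S : Finset (List (Fin n))}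

lemma mem_freeWords {m : ℕ} {w : List (Fin n)} :
    w ∈ freeWords T S m ↔ w.length = m ∧ Admissible T w ∧ SFree S w := by
  simp [freeWords]

lemma mem_extWords {m : ℕ} {w : List (Fin n)} :
    w ∈ extWords T S m ↔ w.length = m + 1 ∧ Admissible T w ∧ SFree S w.tail := by
  simp [extWords]

lemma Admissible.subword {w w' : List (Fin n)} (h : Admissible T w) (hw : w' <:+: w) :
    Admissible T w' := by
  obtain ⟨s, t, rfl⟩ := hw
  exact (List.isChain_append.1 (List.isChain_append.1 h).1).2.1

lemma SFree.subword {w w' : List (Fin n)} (h : SFree S w) (hw : w' <:+: w) : SFree S w' :=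
  fun τ hτ hi => h τ hτ (hi.trans hw)

variable {lam : ℝ} {v : Fin n → ℝ}

lemma headWeight_nonneg (hlam : 0 < lam) (hv : ∀ i, 0 < v i) (w : List (Fin n)) :
    0 ≤ headWeight lam v w := by
  cases w with
  | nil => exact div_nonneg (Finset.sum_nonneg fun i _ => (hv i).le) hlam.le
  | cons a w => exact (hv a).le

lemma le_headWeight_nil (hT01 : ∀ i j, T i j = 0 ∨ T i j = 1) (hlam : 0 < lam)
    (hv : ∀ i, 0 < v i) (hTv : T.mulVec v = lam • v) (i : Fin n) :
    v i ≤ headWeight lam v [] := by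
  rw [headWeight, le_div_iff₀ hlam]
  have h := congrFun hTv i
  simp only [Matrix.mulVec, dotProduct, Pi.smul_apply, smul_eq_mul] at h
  rw [mul_comm, ← h]
  refine Finset.sum_le_sum fun j _ => ?_
  rcases hT01 i j with h | h <;> simp [h, (hv j).le]

/-- Weights of any two words differ by a factor of at most `D`, the left one being nonempty. -/
lemma headWeight_cons_le (hT01 : ∀ i j, T i j = 0 ∨ T i j = 1) (hlam : 0 < lam)
    (hv : ∀ i, 0 < v i) (hTv : T.mulVec v = lam • v) {D : ℝ} (hD : ∀ i j, v i / v j ≤ D)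
    (a : Fin n) (w w' : List (Fin n)) :
    headWeight lam v (a :: w) ≤ D * headWeight lam v w' := by
  have hD' : ∀ i j, v i ≤ D * v j := fun i j => (div_le_iff₀ (hv j)).1 (hD i j)
  cases w' with
  | nil =>
    have hD0 : 0 ≤ D := le_trans (div_nonneg (hv a).le (hv a).le) (hD a a)
    exact (hD' a a).trans
      (mul_le_mul_of_nonneg_left (le_headWeight_nil hT01 hlam hv hTv a) hD0)
  | cons b w' => exact hD' a b

open Classical in
lemma sum_left_extensions (hT01 : ∀ i j, T i j = 0 ∨ T i j = 1) (hlam : 0 < lam)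
    (hTv : T.mulVec v = lam • v) {w : List (Fin n)} (hw : Admissible T w) :
    ∑ a, (if Admissible T (a :: w) then v a else 0) = lam * headWeight lam v w := by
  cases w with
  | nil =>
    have h : ∀ a, Admissible T [a] := fun a => List.isChain_singleton a
    simp only [h, if_true, headWeight]
    field_simp
  | cons b w =>
    have h : ∀ a, Admissible T (a :: b :: w) ↔ T b a = 1 := fun a =>
      List.isChain_cons_cons.trans (and_iff_left hw)
    simp only [h, headWeight]
    have h2 := congrFun hTv b
    simp only [Matrix.mulVec, dotProduct, Pi.smul_apply, smul_eq_mul] at h2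
    rw [← h2]
    refine Finset.sum_congr rfl fun a _ => ?_
    rcases hT01 b a with h | h <;> simp [h]

lemma sum_extWords (hT01 : ∀ i j, T i j = 0 ∨ T i j = 1) (hlam : 0 < lam)
    (hTv : T.mulVec v = lam • v) (m : ℕ) :
    ∑ w ∈ extWords T S m, headWeight lam v w
      = lam * ∑ w ∈ freeWords T S m, headWeight lam v w := by
  classical
  rw [Finset.mul_sum]
  have h1 : ∀ w ∈ freeWords T S m, lam * headWeight lam v w
      = ∑ a, (if Admissible T (a :: w) then v a else 0) := fun w hw =>
    (sum_left_extensions hT01 hlam hTv (mem_freeWords.1 hw).2.1).symm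
  rw [Finset.sum_congr rfl h1, ← Finset.sum_product', ← Finset.sum_filter]
  symm
  refine Finset.sum_bij (fun p _ => p.2 :: p.1) ?_ ?_ ?_ ?_
  · rintro ⟨w, a⟩ h
    simp only [Finset.mem_filter, Finset.mem_product, mem_freeWords] at h
    exact mem_extWords.2 ⟨by simp [h.1.1.1], h.2, h.1.1.2.2⟩
  · rintro ⟨w, a⟩ - ⟨w', a'⟩ - h
    simp only [List.cons.injEq] at h
    simp [h.1, h.2]
  · intro w hw
    obtain ⟨h1, h2, h3⟩ := mem_extWords.1 hw
    cases w with
    | nil => simp at h1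
    | cons a w =>
      refine ⟨(w, a), ?_, rfl⟩
      simp only [Finset.mem_filter, Finset.mem_product, mem_freeWords, Finset.mem_univ]
      exact ⟨⟨⟨by simpa using h1, h2.subword (List.suffix_cons a w).isInfix, h3⟩, trivial⟩, h2⟩
  · rintro ⟨w, a⟩ -
    rfl

lemma freeWords_subset_extWords (m : ℕ) : freeWords T S (m + 1) ⊆ extWords T S m := by
  intro w hw
  obtain ⟨h1, h2, h3⟩ := mem_freeWords.1 hw
  exact mem_extWords.2 ⟨h1, h2, h3.subword (List.tail_suffix w).isInfix⟩

lemma sum_freeWords_le (hT01 : ∀ i j, T i j = 0 ∨ T i j = 1) (hlam : 0 < lam)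
    (hv : ∀ i, 0 < v i) (hTv : T.mulVec v = lam • v) (m : ℕ) :
    ∑ w ∈ freeWords T S m, headWeight lam v w ≤ lam ^ m * headWeight lam v [] := by
  induction m with
  | zero =>
    have h : freeWords T S 0 ⊆ {[]} := fun w hw => by
      simpa using (mem_freeWords.1 hw).1
    simpa using Finset.sum_le_sum_of_subset_of_nonneg h
      fun w _ _ => headWeight_nonneg hlam hv w
  | succ m ih =>
    calc _ ≤ ∑ w ∈ extWords T S m, headWeight lam v w :=
          Finset.sum_le_sum_of_subset_of_nonneg (freeWords_subset_extWords m)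
            fun w _ _ => headWeight_nonneg hlam hv w
      _ = lam * ∑ w ∈ freeWords T S m, headWeight lam v w := sum_extWords hT01 hlam hTv m
      _ ≤ lam * (lam ^ m * headWeight lam v []) := by gcongr
      _ = _ := by ring

open Classical in
/-- Words with prefix `τ` and `S`-free tail are controlled by shorter `S`-free words. -/
lemma sum_extWords_prefix_le (hT01 : ∀ i j, T i j = 0 ∨ T i j = 1) (hlam : 0 < lam)
    (hv : ∀ i, 0 < v i) (hTv : T.mulVec v = lam • v) {D : ℝ} (hD : ∀ i j, v i / v j ≤ D)
    (k l : ℕ) {τ : List (Fin n)} (hτ : τ.length = k + 1) :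
    ∑ w ∈ (extWords T S (k + l)).filter (τ <+: ·), headWeight lam v w
      ≤ D * ∑ w ∈ freeWords T S l, headWeight lam v w := by
  rw [Finset.mul_sum]
  calc _ ≤ ∑ w ∈ (extWords T S (k + l)).filter (τ <+: ·),
          D * headWeight lam v (w.drop (k + 1)) := by
        refine Finset.sum_le_sum fun w hw => ?_
        have h := (mem_extWords.1 (Finset.mem_filter.1 hw).1).1
        cases w with
        | nil => simp at h
        | cons a w => exact headWeight_cons_le hT01 hlam hv hTv hD a w _
    _ = ∑ w ∈ ((extWords T S (k + l)).filter (τ <+: ·)).image (List.drop (k + 1)),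
          D * headWeight lam v w := by
        rw [Finset.sum_image]
        intro w hw w' hw' h
        obtain ⟨x, rfl⟩ := (Finset.mem_filter.1 hw).2
        obtain ⟨x', rfl⟩ := (Finset.mem_filter.1 hw').2
        simp only [← hτ, List.drop_left] at h
        rw [h]
    _ ≤ _ := by
        refine Finset.sum_le_sum_of_subset_of_nonneg ?_ fun w hw _ => ?_
        · intro y hy
          obtain ⟨w, hw, rfl⟩ := Finset.mem_image.1 hy
          obtain ⟨h1, h2, h3⟩ := mem_extWords.1 (Finset.mem_filter.1 hw).1
          refine mem_freeWords.2 ⟨?_, h2.subword (List.drop_suffix _ _).isInfix, ?_⟩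
          · rw [List.length_drop, h1]; omega
          · rw [← List.drop_tail]
            exact h3.subword (List.drop_suffix _ _).isInfix
        · obtain ⟨a⟩ : Nonempty (Fin n) := ⟨τ.head (by rintro rfl; simp at hτ)⟩
          have hD0 : 0 ≤ D := le_trans (div_nonneg (hv a).le (hv a).le) (hD a a)
          exact mul_nonneg hD0 (headWeight_nonneg hlam hv _)

open Classical in
lemma sum_extWords_le (hlam : 0 < lam) (hv : ∀ i, 0 < v i) (m : ℕ) :
    ∑ w ∈ extWords T S m, headWeight lam v w ≤ ∑ w ∈ freeWords T S (m + 1), headWeight lam v w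
      + ∑ τ ∈ S, ∑ w ∈ (extWords T S m).filter (τ <+: ·), headWeight lam v w := by
  have hsub : ∑ w ∈ (extWords T S m).filter (SFree S ·), headWeight lam v w
      ≤ ∑ w ∈ freeWords T S (m + 1), headWeight lam v w := by
    refine Finset.sum_le_sum_of_subset_of_nonneg (fun w hw => ?_)
      fun w _ _ => headWeight_nonneg hlam hv w
    obtain ⟨h, hf⟩ := Finset.mem_filter.1 hw
    obtain ⟨h1, h2, -⟩ := mem_extWords.1 h
    exact mem_freeWords.2 ⟨h1, h2, hf⟩
  refine le_trans ?_ (add_le_add_left hsub _)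
  simp only [Finset.sum_filter]
  rw [Finset.sum_comm, ← Finset.sum_add_distrib]
  refine Finset.sum_le_sum fun w hw => ?_
  have hnn : ∀ τ ∈ S, 0 ≤ if τ <+: w then headWeight lam v w else 0 := fun τ _ => by
    split_ifs
    exacts [headWeight_nonneg hlam hv w, le_rfl]
  by_cases hf : SFree S w
  · simpa [hf] using Finset.sum_nonneg hnn
  · obtain ⟨τ, hτ, hi⟩ : ∃ τ ∈ S, τ <:+: w := by simpa [SFree] using hf
    obtain ⟨h1, -, h3⟩ := mem_extWords.1 hw
    have hp : τ <+: w := by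
      cases w with
      | nil => simp at h1
      | cons a w => exact (List.infix_cons_iff.1 hi).resolve_right (h3 τ hτ)
    have h := Finset.single_le_sum hnn hτ
    simpa [hf, hp] using h

/-- The growth estimate for the weighted number of `S`-free words. -/
lemma mul_sum_freeWords_le (hT01 : ∀ i j, T i j = 0 ∨ T i j = 1) (hlam : 0 < lam)
    (hv : ∀ i, 0 < v i) (hTv : T.mulVec v = lam • v) {D : ℝ} (hD : ∀ i j, v i / v j ≤ D)
    (hSne : ∀ τ ∈ S, τ ≠ []) (hD0 : 0 ≤ D) {x β : ℝ} (hx : 0 < x) (hβx : 1 ≤ β * x)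
    (hβ : β * x + D * wordPoly S x ≤ lam * x) (m : ℕ) :
    β * ∑ w ∈ freeWords T S m, headWeight lam v w
      ≤ ∑ w ∈ freeWords T S (m + 1), headWeight lam v w := by
  classical
  set W : ℕ → ℝ := fun m => ∑ w ∈ freeWords T S m, headWeight lam v w with hW
  have hW0 : ∀ m, 0 ≤ W m := fun m => Finset.sum_nonneg fun w _ => headWeight_nonneg hlam hv w
  change β * W m ≤ W (m + 1)
  induction m using Nat.strong_induction_on with
  | _ m ih =>
  have hback : ∀ k l, k + l = m → W l ≤ x ^ k * W m := by
    intro k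
    induction k with
    | zero => intro l hl; obtain rfl : l = m := by omega
              simp
    | succ k ihk =>
      intro l hl
      have h1 := ihk (l + 1) (by omega)
      have h2 := ih l (by omega)
      have h3 : W l ≤ x * W (l + 1) := by
        nlinarith [mul_le_mul_of_nonneg_left h2 hx.le, mul_le_mul_of_nonneg_right hβx (hW0 l)]
      calc W l ≤ x * W (l + 1) := h3
        _ ≤ x * (x ^ k * W m) := by gcongr
        _ = _ := by ring
  have hbad : ∀ τ ∈ S, x * ∑ w ∈ (extWords T S m).filter (τ <+: ·), headWeight lam v w
      ≤ D * x ^ τ.length * W m := by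
    intro τ hτ
    obtain ⟨k, hk⟩ : ∃ k, τ.length = k + 1 :=
      Nat.exists_eq_succ_of_ne_zero (by simpa using hSne τ hτ)
    by_cases hkm : k ≤ m
    · obtain ⟨l, rfl⟩ := Nat.exists_eq_add_of_le hkm
      calc _ ≤ x * (D * W l) := by
            gcongr
            exact sum_extWords_prefix_le hT01 hlam hv hTv hD k l hk
        _ ≤ x * (D * (x ^ k * W (k + l))) := by gcongr; exact hback k l rfl
        _ = _ := by rw [hk]; ring
    · have he : (extWords T S m).filter (τ <+: ·) = ∅ := by
        refine Finset.filter_eq_empty_iff.2 fun w hw hp => ?_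
        have := (mem_extWords.1 hw).1
        have := hp.length_le
        omega
      rw [he]
      simp only [Finset.sum_empty, mul_zero]
      have := hW0 m
      positivity
  have hsum := sum_extWords_le (T := T) (S := S) hlam hv m
  rw [sum_extWords hT01 hlam hTv m] at hsum
  have htot := Finset.sum_le_sum hbad
  rw [← Finset.mul_sum, ← Finset.sum_mul, ← Finset.mul_sum] at htot
  change _ ≤ D * wordPoly S x * W m at htot
  change lam * W m ≤ W (m + 1) + _ at hsum
  have h1 := mul_le_mul_of_nonneg_left hsum hx.le
  have h2 := mul_le_mul_of_nonneg_right hβ (hW0 m)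
  refine le_of_mul_le_mul_left ?_ hx
  linarith

lemma card_freeWords_le (hT01 : ∀ i j, T i j = 0 ∨ T i j = 1) (hlam : 0 < lam)
    (hv : ∀ i, 0 < v i) (hTv : T.mulVec v = lam • v) {D : ℝ} (hD : ∀ i j, v i / v j ≤ D)
    (i₀ : Fin n) (m : ℕ) :
    ((freeWords T S (m + 1)).card : ℝ) ≤ D * headWeight lam v [] / v i₀ * lam ^ (m + 1) := by
  have hD0 : 0 ≤ D := le_trans (div_nonneg (hv i₀).le (hv i₀).le) (hD i₀ i₀)
  have h1 : ((freeWords T S (m + 1)).card : ℝ) * v i₀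
      ≤ D * ∑ w ∈ freeWords T S (m + 1), headWeight lam v w := by
    rw [← nsmul_eq_mul, ← Finset.sum_const, Finset.mul_sum]
    refine Finset.sum_le_sum fun w _ => ?_
    exact headWeight_cons_le hT01 hlam hv hTv hD i₀ [] w
  have h2 := sum_freeWords_le (S := S) hT01 hlam hv hTv (m + 1)
  rw [div_mul_eq_mul_div, le_div_iff₀ (hv i₀)]
  nlinarith [mul_le_mul_of_nonneg_left h2 hD0]

lemma le_card_freeWords (hT01 : ∀ i j, T i j = 0 ∨ T i j = 1) (hlam : 0 < lam)
    (hv : ∀ i, 0 < v i) (hTv : T.mulVec v = lam • v) {D : ℝ} (hD : ∀ i j, v i / v j ≤ D)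
    (hSne : ∀ τ ∈ S, τ ≠ []) (i₀ : Fin n) {x β : ℝ} (hx : 0 < x) (hβx : 1 ≤ β * x)
    (hβ : β * x + D * wordPoly S x ≤ lam * x) (m : ℕ) :
    β ^ (m + 1) ≤ D * ((freeWords T S (m + 1)).card : ℝ) := by
  have hD0 : 0 ≤ D := le_trans (div_nonneg (hv i₀).le (hv i₀).le) (hD i₀ i₀)
  have hβ0 : 0 < β := pos_of_mul_pos_left (one_pos.trans_le hβx) hx.le
  have h0 : 0 < headWeight lam v [] :=
    (hv i₀).trans_le (le_headWeight_nil hT01 hlam hv hTv i₀)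
  have hW : ∀ m, β ^ m * headWeight lam v [] ≤ ∑ w ∈ freeWords T S m, headWeight lam v w := by
    intro m
    induction m with
    | zero =>
      have h : [] ∈ freeWords T S 0 :=
        mem_freeWords.2 ⟨rfl, List.isChain_nil, fun τ hτ hi => hSne τ hτ (List.infix_nil.1 hi)⟩
      simpa using Finset.single_le_sum (fun w _ => headWeight_nonneg hlam hv w) h
    | succ m ih =>
      refine le_trans ?_ (mul_sum_freeWords_le hT01 hlam hv hTv hD hSne hD0 hx hβx hβ m)
      rw [pow_succ', mul_assoc]
      gcongr
  have h2 : ∑ w ∈ freeWords T S (m + 1), headWeight lam v w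
      ≤ ((freeWords T S (m + 1)).card : ℝ) * (D * headWeight lam v []) := by
    rw [← nsmul_eq_mul, ← Finset.sum_const]
    refine Finset.sum_le_sum fun w hw => ?_
    have h := (mem_freeWords.1 hw).1
    cases w with
    | nil => simp at h
    | cons a w => exact headWeight_cons_le hT01 hlam hv hTv hD a w _
  refine le_of_mul_le_mul_right ?_ h0
  linarith [hW (m + 1)]

end Words

section Language

variable {n : ℕ} {T : Matrix (Fin n) (Fin n) ℝ} {S : Finset (List (Fin n))}

lemma subword_of_occursAt {A : Type*} {τ w : List A} {x : ℤ → A} {a : ℤ} {k : ℕ}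
    (hw : OccursAt w x a) (hτ : OccursAt τ x (a + k)) (hk : k + τ.length ≤ w.length) :
    τ <:+: w := by
  refine ⟨w.take k, w.drop (k + τ.length), ?_⟩
  have h : τ = (w.drop k).take τ.length := by
    refine List.ext_getElem (by simp; omega) fun i h1 h2 => ?_
    have e1 := hτ i h1
    have e2 := hw (k + i) (by omega)
    simp only [List.get_eq_getElem] at e1 e2
    rw [List.getElem_take, List.getElem_drop, ← e1, ← e2]
    push_cast
    ring_nf
  have e : τ ++ w.drop (k + τ.length) = w.drop k := by
    conv_rhs => rw [← List.take_append_drop τ.length (w.drop k), ← h, List.drop_drop]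
  rw [List.append_assoc, e, List.take_append_drop]

lemma admissible_of_occurs {w : List (Fin n)} {x : ℤ → Fin n} (hx : x ∈ SFTspace T)
    (hw : Occurs w x) : Admissible T w := by
  obtain ⟨a, ha⟩ := hw
  refine List.isChain_iff_getElem.2 fun i hi => ?_
  have e1 := ha i (by omega)
  have e2 := ha (i + 1) hi
  have h := hx (a + i)
  simp only [List.get_eq_getElem] at e1 e2
  rw [← e1, ← e2]
  convert h using 3
  push_cast
  ring

lemma sFree_empty {A : Type*} (w : List A) : SFree ∅ w := fun τ hτ => by simp at hτ

lemma wordCount_le_card {X : Set (ℤ → Fin n)} (hX : X ⊆ SFTspace T) (m : ℕ) :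
    wordCount X m ≤ (freeWords T ∅ m).card := by
  rw [wordCount, ← Set.ncard_coe_finset]
  refine Set.ncard_le_ncard ?_ (Finset.finite_toSet _)
  rintro w ⟨hw, x, hx, ho⟩
  exact mem_freeWords.2 ⟨hw, admissible_of_occurs (hX hx) ho, sFree_empty w⟩

/-- The bi-infinite sequences whose transitions and `S`-freeness are only imposed on the
coordinates in `[-k, k)`. -/
def windowAvoid (T : Matrix (Fin n) (Fin n) ℝ) (S : Finset (List (Fin n))) (k : ℕ) :
    Set (ℤ → Fin n) :=
  {x | (∀ i : ℤ, -k ≤ i → i + 1 < k → T (x (i + 1)) (x i) = 1) ∧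
    ∀ τ ∈ S, ∀ a : ℤ, -k ≤ a → a + τ.length ≤ k → ¬ OccursAt τ x a}

lemma windowAvoid_anti : Antitone (windowAvoid T S) := fun k l hkl x hx => by
  have : (k : ℤ) ≤ l := by exact_mod_cast hkl
  exact ⟨fun i h1 h2 => hx.1 i (by omega) (by omega),
    fun τ hτ a h1 h2 => hx.2 τ hτ a (by omega) (by omega)⟩

lemma mem_avoid_of_forall_mem_windowAvoid {x : ℤ → Fin n}
    (hx : ∀ k, x ∈ windowAvoid T S k) : x ∈ Avoid T S := by
  refine ⟨fun i => (hx (i.natAbs + 2)).1 i (by omega) (by omega), ?_⟩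
  rintro τ hτ ⟨a, ha⟩
  exact (hx (a.natAbs + τ.length)).2 τ hτ a (by omega) (by omega) ha

lemma isClopen_occursAt {A : Type*} [TopologicalSpace A] [DiscreteTopology A] (w : List A)
    (a : ℤ) : IsClopen {x : ℤ → A | OccursAt w x a} := by
  have h : {x : ℤ → A | OccursAt w x a}
      = ⋂ j : Fin w.length, (fun x : ℤ → A => x (a + (j : ℕ))) ⁻¹' {w.get j} := by
    ext x
    simp only [OccursAt, Set.mem_ofPred_eq, Set.mem_iInter, Set.mem_preimage,
      Set.mem_singleton_iff]
    exact ⟨fun h j => h j j.2, fun h j hj => h ⟨j, hj⟩⟩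
  rw [h]
  exact isClopen_iInter_of_finite fun j =>
    (isClopen_discrete _).preimage (continuous_apply _)

lemma isClosed_windowAvoid (k : ℕ) : IsClosed (windowAvoid T S k) := by
  have h1 : ∀ i : ℤ, IsClosed {x : ℤ → Fin n | T (x (i + 1)) (x i) = 1} := fun i =>
    (isClosed_discrete {p : Fin n × Fin n | T p.1 p.2 = 1}).preimage
      (f := fun x : ℤ → Fin n => (x (i + 1), x i)) (by fun_prop)
  have h2 : ∀ (τ : List (Fin n)) (a : ℤ), IsClosed {x : ℤ → Fin n | ¬ OccursAt τ x a} :=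
    fun τ a => (isClopen_occursAt τ a).compl.isClosed
  simp only [windowAvoid, Set.ofPred_and, Set.ofPred_forall]
  exact (isClosed_iInter fun i => isClosed_iInter fun _ => isClosed_iInter fun _ => h1 i).inter
    (isClosed_iInter fun τ => isClosed_iInter fun _ => isClosed_iInter fun a =>
      isClosed_iInter fun _ => isClosed_iInter fun _ => h2 τ a)

/-- By compactness, words occurring in every window system occur in `Σ⟨S⟩`. -/
lemma exists_mem_avoid_of_forall_window {w : List (Fin n)}
    (h : ∀ k, ∃ x ∈ windowAvoid T S k, OccursAt w x 0) : ∃ x ∈ Avoid T S, Occurs w x := by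
  have hcl : ∀ k, IsClosed (windowAvoid T S k ∩ {x | OccursAt w x 0}) := fun k =>
    (isClosed_windowAvoid k).inter (isClopen_occursAt w 0).isClosed
  obtain ⟨x, hx⟩ := IsCompact.nonempty_iInter_of_sequence_nonempty_isCompact_isClosed
    (fun k => windowAvoid T S k ∩ {x | OccursAt w x 0})
    (fun k => Set.inter_subset_inter_left _ (windowAvoid_anti k.le_succ))
    h (hcl 0).isCompact hcl
  rw [Set.mem_iInter] at hx
  exact ⟨x, mem_avoid_of_forall_mem_windowAvoid fun k => (hx k).1, 0, (hx 0).2⟩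

lemma exists_window_forall (m : ℕ) : ∃ K, ∀ w : List (Fin n), w.length = m →
    (∃ x ∈ windowAvoid T S K, OccursAt w x 0) → ∃ x ∈ Avoid T S, Occurs w x := by
  have h : ∀ w : List (Fin n), ∃ k, (∃ x ∈ windowAvoid T S k, OccursAt w x 0) →
      ∃ x ∈ Avoid T S, Occurs w x := by
    intro w
    by_contra! hc
    obtain ⟨x, hx, ho⟩ := exists_mem_avoid_of_forall_window fun k => (hc k).1
    exact (hc 0).2 x hx ho
  choose k hk using h
  obtain ⟨K, hK⟩ := ((List.finite_length_eq (Fin n) m).toFinset.image k).exists_le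
  refine ⟨K, fun w hw ⟨x, hx, ho⟩ => hk w ⟨x, windowAvoid_anti (hK _ ?_) hx, ho⟩⟩
  exact Finset.mem_image_of_mem _ (by simpa using hw)

/-- An `S`-free word with margins of length at least `K` around `w` yields an element of the
window system containing `w`. -/
lemma exists_windowAvoid_of_append {K : ℕ} {P w Q : List (Fin n)} (hP : K ≤ P.length)
    (hQ : K ≤ Q.length) (hadm : Admissible T (P ++ w ++ Q)) (hfree : SFree S (P ++ w ++ Q))
    [Nonempty (Fin n)] : ∃ x ∈ windowAvoid T S K, OccursAt w x 0 := by
  obtain ⟨d⟩ := ‹Nonempty (Fin n)›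
  set W := P ++ w ++ Q with hW
  have hlen : W.length = P.length + w.length + Q.length := by simp [hW]; omega
  let x : ℤ → Fin n := fun i => W.getD (i + P.length).toNat d
  have hx : ∀ j (hj : j < W.length), x (-(P.length : ℤ) + j) = W[j] := fun j hj => by
    have : (-(P.length : ℤ) + j + P.length).toNat = j := by omega
    simp only [x, this, List.getD_eq_getElem _ _ hj]
  have hocc : OccursAt W x (-P.length) := fun j hj => hx j hj
  refine ⟨x, ⟨fun i h1 h2 => ?_, fun τ hτ a h1 h2 ho => ?_⟩, fun j hj => ?_⟩
  · obtain ⟨j, rfl⟩ : ∃ j : ℕ, i = -(P.length : ℤ) + j := ⟨(i + P.length).toNat, by omega⟩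
    have h := List.isChain_iff_getElem.1 hadm j (by omega)
    rw [← hx j (by omega), ← hx (j + 1) (by omega)] at h
    rw [add_assoc]
    exact_mod_cast h
  · obtain ⟨j, rfl⟩ : ∃ j : ℕ, a = -(P.length : ℤ) + j := ⟨(a + P.length).toNat, by omega⟩
    exact hfree τ hτ (subword_of_occursAt hocc ho (by omega))
  · have h := hx (P.length + j) (by omega)
    have e : -(P.length : ℤ) + (P.length + j : ℕ) = 0 + j := by push_cast; ring
    rw [e] at h
    rw [h]
    simp [hW, hj]

/-- The words of length `l` sitting inside an admissible `S`-free word with margins of length at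
least `K` on both sides. -/
def innerWords (T : Matrix (Fin n) (Fin n) ℝ) (S : Finset (List (Fin n))) (K l : ℕ) :
    Set (List (Fin n)) :=
  {w | w.length = l ∧ ∃ P Q : List (Fin n), K ≤ P.length ∧ K ≤ Q.length ∧
    Admissible T (P ++ w ++ Q) ∧ SFree S (P ++ w ++ Q)}

lemma finite_innerWords (K l : ℕ) : (innerWords T S K l).Finite :=
  (List.finite_length_eq (Fin n) l).subset fun _ h => h.1

lemma ncard_innerWords_add_le (K m l : ℕ) :
    (innerWords T S K (m + l)).ncard
      ≤ (innerWords T S K m).ncard * (innerWords T S K l).ncard := by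
  rw [← Set.ncard_prod]
  refine Set.ncard_le_ncard_of_injOn (fun w => (w.take m, w.drop m)) ?_ ?_
    ((finite_innerWords K m).prod (finite_innerWords K l))
  · rintro w ⟨hw, P, Q, hP, hQ, ha, hf⟩
    refine ⟨⟨by simp [hw], P, w.drop m ++ Q, hP, by simp; omega, ?_⟩,
      by simp [hw], P ++ w.take m, Q, by simp; omega, hQ, ?_⟩
    · have e : P ++ w.take m ++ (w.drop m ++ Q) = P ++ w ++ Q := by
        rw [← List.append_assoc, List.append_assoc P, List.take_append_drop]
      rw [e]; exact ⟨ha, hf⟩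
    · have e : P ++ w.take m ++ w.drop m ++ Q = P ++ w ++ Q := by
        rw [List.append_assoc P, List.take_append_drop]
      rw [e]; exact ⟨ha, hf⟩
  · intro w _ w' _ h
    simp only [Prod.mk.injEq] at h
    rw [← List.take_append_drop m w, h.1, h.2, List.take_append_drop]

lemma ncard_innerWords_mul_le (K m j : ℕ) :
    (innerWords T S K (m * j)).ncard ≤ (innerWords T S K m).ncard ^ j := by
  induction j with
  | zero =>
    have h : innerWords T S K (m * 0) ⊆ {[]} := fun w hw => by simpa using hw.1
    simpa using Set.ncard_le_ncard h
  | succ j ih =>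
    rw [Nat.mul_succ, add_comm, pow_succ']
    exact (ncard_innerWords_add_le K m _).trans (Nat.mul_le_mul_left _ ih)

lemma card_freeWords_le_innerWords (K l : ℕ) :
    (freeWords T S (K + l + K)).card
      ≤ {w : List (Fin n) | w.length = K}.ncard * (innerWords T S K l).ncard
        * {w : List (Fin n) | w.length = K}.ncard := by
  rw [← Set.ncard_coe_finset, ← Set.ncard_prod, ← Set.ncard_prod]
  have hfin := List.finite_length_eq (Fin n) K
  refine Set.ncard_le_ncard_of_injOn
    (fun w => ((w.take K, (w.drop K).take l), (w.drop K).drop l)) ?_ ?_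
    ((hfin.prod (finite_innerWords K l)).prod hfin)
  · intro w hw
    obtain ⟨h1, h2, h3⟩ := mem_freeWords.1 hw
    have e : w.take K ++ (w.drop K).take l ++ (w.drop K).drop l = w := by
      rw [List.append_assoc, List.take_append_drop, List.take_append_drop]
    refine ⟨⟨by simp [h1, add_assoc], by simp [h1, add_assoc], w.take K, (w.drop K).drop l,
      by simp [h1, add_assoc], by simp [h1], ?_⟩, by simp [h1]⟩
    rw [e]
    exact ⟨h2, h3⟩
  · intro w _ w' _ h
    simp only [Prod.mk.injEq] at h
    rw [← List.take_append_drop K w, ← List.take_append_drop l (w.drop K), h.1.1, h.1.2, h.2,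
      List.take_append_drop, List.take_append_drop]

/-- Exponential growth of the `S`-free words passes to the language of `Σ⟨S⟩`. -/
lemma pow_le_wordCount_avoid [Nonempty (Fin n)] {β D : ℝ} (hβ : 0 < β)
    (h : ∀ m, β ^ (m + 1) ≤ D * ((freeWords T S (m + 1)).card : ℝ)) {m : ℕ} (hm : 0 < m) :
    β ^ m ≤ wordCount (Avoid T S) m := by
  obtain ⟨K, hK⟩ := exists_window_forall (T := T) (S := S) m
  set c : ℕ := {w : List (Fin n) | w.length = K}.ncard
  have hin : (innerWords T S K m).ncard ≤ wordCount (Avoid T S) m := by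
    refine Set.ncard_le_ncard ?_ ((List.finite_length_eq (Fin n) m).subset fun _ h => h.1)
    rintro w ⟨hw, P, Q, hP, hQ, ha, hf⟩
    exact ⟨hw, hK w hw (exists_windowAvoid_of_append hP hQ ha hf)⟩
  obtain ⟨L, hL⟩ : ∃ L : ℝ, (wordCount (Avoid T S) m : ℝ) = L := ⟨_, rfl⟩
  have hL0 : 0 ≤ L := hL ▸ Nat.cast_nonneg _
  have hinL : ((innerWords T S K m).ncard : ℝ) ≤ L := hL ▸ Nat.cast_le.2 hin
  rw [hL]
  have hD : 0 < D := pos_of_mul_pos_left ((pow_pos hβ 1).trans_le (h 0)) (Nat.cast_nonneg _)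
  have key : ∀ j : ℕ, (β ^ m) ^ (j + 1) ≤ D * c * c / β ^ (2 * K) * L ^ (j + 1) := by
    intro j
    obtain ⟨s, hs⟩ : ∃ s, K + m * (j + 1) + K = s + 1 :=
      Nat.exists_eq_succ_of_ne_zero (by positivity)
    have h1 := h s
    rw [← hs] at h1
    have h2 : ((freeWords T S (K + m * (j + 1) + K)).card : ℝ) ≤ c * L ^ (j + 1) * c := by
      refine le_trans (b := ((c * (innerWords T S K m).ncard ^ (j + 1) * c : ℕ) : ℝ)) ?_ ?_
      · refine Nat.cast_le.2 ((card_freeWords_le_innerWords K _).trans ?_)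
        gcongr
        exact ncard_innerWords_mul_le K m _
      · push_cast
        gcongr
    rw [div_mul_eq_mul_div, le_div_iff₀ (by positivity)]
    calc (β ^ m) ^ (j + 1) * β ^ (2 * K) = β ^ (K + m * (j + 1) + K) := by
          rw [← pow_mul, ← pow_add]; congr 1; ring
      _ ≤ D * (c * L ^ (j + 1) * c) := h1.trans (by gcongr)
      _ = _ := by ring
  by_contra! hlt
  have hβm : 0 < β ^ m := pow_pos hβ m
  have hr0 : 0 ≤ L / β ^ m := by positivity
  have hr1 : L / β ^ m < 1 := (div_lt_one hβm).2 hlt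
  have ht := ((tendsto_pow_atTop_nhds_zero_of_lt_one hr0 hr1).comp
    (tendsto_add_atTop_nat 1)).const_mul (D * c * c / β ^ (2 * K))
  rw [mul_zero] at ht
  refine absurd (ge_of_tendsto' ht fun j => ?_) (not_le.2 one_pos)
  rw [Function.comp_apply, div_pow, ← mul_div_assoc, le_div_iff₀ (by positivity), one_mul]
  exact key j

end Language

lemma log_wordCount_div_le {A : Type*} {X : Set (ℤ → A)} {C lam : ℝ} (hlam : 1 ≤ lam)
    (hC : 1 ≤ C) (h : ∀ m : ℕ, (wordCount X (m + 1) : ℝ) ≤ C * lam ^ (m + 1)) :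
    ∀ m : ℕ, 0 < m → Real.log (wordCount X m) / m ≤ Real.log C / m + Real.log lam := by
  intro m hm
  obtain ⟨s, rfl⟩ := Nat.exists_eq_succ_of_ne_zero hm.ne'
  have hm' : (0 : ℝ) < (s + 1 : ℕ) := Nat.cast_pos.2 hm
  rw [div_add' _ _ _ hm'.ne', div_le_div_iff_of_pos_right hm', mul_comm (Real.log lam),
    ← Real.log_pow, ← Real.log_mul (by positivity) (by positivity)]
  rcases Nat.eq_zero_or_pos (wordCount X (s + 1)) with h0 | h0
  · rw [h0, Nat.cast_zero, Real.log_zero]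
    exact Real.log_nonneg (one_le_mul_of_one_le_of_one_le hC (one_le_pow₀ hlam))
  · exact Real.log_le_log (Nat.cast_pos.2 h0) (h s)

lemma tendsto_log_div_add (C lam : ℝ) :
    Tendsto (fun m : ℕ => Real.log C / m + Real.log lam) atTop (nhds (Real.log lam)) := by
  simpa using (tendsto_const_div_atTop_nhds_zero_nat (Real.log C)).add_const (Real.log lam)

lemma entropy_le_log {A : Type*} {X : Set (ℤ → A)} {C lam : ℝ} (hlam : 1 ≤ lam)
    (hC : 1 ≤ C) (h : ∀ m : ℕ, (wordCount X (m + 1) : ℝ) ≤ C * lam ^ (m + 1)) :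
    entropy X ≤ Real.log lam := by
  have ht := tendsto_log_div_add C lam
  rw [← ht.limsup_eq]
  refine limsup_le_limsup ?_ ?_ ht.isBoundedUnder_le
  · filter_upwards [eventually_gt_atTop 0] with m hm
    exact log_wordCount_div_le hlam hC h m hm
  · refine IsBoundedUnder.isCoboundedUnder_le ⟨0, ?_⟩
    rw [eventually_map]
    exact Eventually.of_forall fun m => div_nonneg (Real.log_natCast_nonneg _) (Nat.cast_nonneg _)

lemma log_le_entropy {A : Type*} {X : Set (ℤ → A)} {C lam β : ℝ} (hlam : 1 ≤ lam)
    (hC : 1 ≤ C) (h : ∀ m : ℕ, (wordCount X (m + 1) : ℝ) ≤ C * lam ^ (m + 1)) (hβ : 0 < β)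
    (hX : ∀ m : ℕ, 0 < m → β ^ m ≤ wordCount X m) :
    Real.log β ≤ entropy X := by
  refine le_limsup_of_frequently_le (Eventually.frequently ?_) ?_
  · filter_upwards [eventually_gt_atTop 0] with m hm
    rw [le_div_iff₀ (Nat.cast_pos.2 hm), mul_comm, ← Real.log_pow]
    exact Real.log_le_log (pow_pos hβ m) (hX m hm)
  · refine (tendsto_log_div_add C lam).isBoundedUnder_le.mono_le ?_
    filter_upwards [eventually_gt_atTop 0] with m hm
    exact log_wordCount_div_le hlam hC h m hm

/-- The lower bound constant for the number of extensions is at most `1`. -/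
lemma extCount_constant_le_one {n : ℕ} [Nonempty (Fin n)] {T : Matrix (Fin n) (Fin n) ℝ}
    {lam A : ℝ} {v : Fin n → ℝ} (hT01 : ∀ i j, T i j = 0 ∨ T i j = 1) (hlam : 0 < lam)
    (hv : ∀ i, 0 < v i) (hTv : T.mulVec v = lam • v)
    (hA : ∀ a : Fin n, A * lam ≤ (extCount T [a] 1 : ℝ)) : A ≤ 1 := by
  classical
  have hext : ∀ a, (extCount T [a] 1 : ℝ) = ∑ b, T b a := by
    intro a
    have h : {η : List (Fin n) | η.length = 1 ∧ Admissible T ([a] ++ η)}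
        = (fun b => [b]) '' {b | T b a = 1} := by
      ext η
      simp only [Set.mem_ofPred_eq, Set.mem_image, List.length_eq_one_iff]
      constructor
      · rintro ⟨⟨b, rfl⟩, h⟩
        exact ⟨b, (List.isChain_cons_cons.1 h).1, rfl⟩
      · rintro ⟨b, h, rfl⟩
        exact ⟨⟨b, rfl⟩, List.isChain_cons_cons.2 ⟨h, List.isChain_singleton b⟩⟩
    rw [extCount, h, Set.ncard_image_of_injective _ List.singleton_injective,
      Set.ncard_eq_toFinset_card', Set.toFinset_ofPred, Finset.card_filter]
    push_cast
    refine Finset.sum_congr rfl fun b _ => ?_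
    rcases hT01 b a with h | h <;> simp [h]
  have hpos : 0 < ∑ a, v a := Finset.sum_pos (fun i _ => hv i) Finset.univ_nonempty
  have h1 : ∑ a, A * lam * v a ≤ ∑ a, (∑ b, T b a) * v a :=
    Finset.sum_le_sum fun a _ => by
      rw [← hext a]
      exact mul_le_mul_of_nonneg_right (hA a) (hv a).le
  have h2 : ∑ a, (∑ b, T b a) * v a = ∑ b, lam * v b := by
    simp only [Finset.sum_mul]
    rw [Finset.sum_comm]
    refine Finset.sum_congr rfl fun b _ => ?_
    simpa [Matrix.mulVec, dotProduct] using congrFun hTv b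
  rw [h2, ← Finset.mul_sum, ← Finset.mul_sum, mul_assoc] at h1
  exact le_of_mul_le_mul_right (by linarith) (mul_pos hlam hpos)

/-- **Proposition 1.** If there is `t > 1` with `r = (1 + D·A⁻¹·p(t/λ))/t < 1`, then
`h(Σ) - h(Σ⟨S⟩) < -log(1 - r)`. -/
theorem entropy_perturbation_bound
    {n : ℕ} (T : Matrix (Fin n) (Fin n) ℝ) (lam : ℝ) (u v : Fin n → ℝ) (A D : ℝ)
    (hT01 : ∀ i j, T i j = 0 ∨ T i j = 1)
    (hirr : ∀ i j : Fin n, ∃ m : ℕ, 0 < m ∧ 0 < (T ^ m) i j)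
    (hlam : 1 < lam)
    (hu : ∀ i, 0 < u i) (hv : ∀ i, 0 < v i)
    (huT : Matrix.vecMul u T = lam • u)
    (hTv : T.mulVec v = lam • v)
    (huv : ∑ i, u i * v i = 1)
    (hA : 0 < A)
    (hAbound : ∀ σ : List (Fin n), Admissible T σ → ∀ k : ℕ, 1 ≤ k →
      A * lam ^ k ≤ (extCount T σ k : ℝ))
    (hD : ∀ i j : Fin n, v i / v j ≤ D)
    (S : Finset (List (Fin n)))
    (hSne : ∀ τ ∈ S, τ ≠ [])
    (hSadm : ∀ τ ∈ S, Admissible T τ)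
    (hSanti : ∀ τ ∈ S, ∀ τ' ∈ S, τ ≠ τ' → ¬ τ <:+: τ')
    (t : ℝ) (ht : 1 < t)
    (hr : (1 + D * A⁻¹ * wordPoly S (t / lam)) / t < 1) :
    entropy (SFTspace T) - entropy (Avoid T S) <
      -Real.log (1 - (1 + D * A⁻¹ * wordPoly S (t / lam)) / t) := by
  obtain ⟨i₀⟩ : Nonempty (Fin n) := by
    by_contra hne
    rw [not_nonempty_iff] at hne
    simp at huv
  have : Nonempty (Fin n) := ⟨i₀⟩
  have hlam0 : 0 < lam := one_pos.trans hlam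
  have ht0 : 0 < t := one_pos.trans ht
  have hA1 : A ≤ 1 := extCount_constant_le_one hT01 hlam0 hv hTv fun a => by
    simpa using hAbound [a] (List.isChain_singleton a) 1 le_rfl
  have hD0 : 0 ≤ D := le_trans (div_nonneg (hv i₀).le (hv i₀).le) (hD i₀ i₀)
  have hp0 : 0 ≤ wordPoly S (t / lam) := Finset.sum_nonneg fun τ _ => by positivity
  set p := wordPoly S (t / lam) with hp
  have hq : D * p ≤ D * A⁻¹ * p := by
    have := (one_le_inv₀ hA).2 hA1
    nlinarith [mul_nonneg hD0 hp0]
  have hrt : 1 + D * A⁻¹ * p < t := by rwa [div_lt_one ht0] at hr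
  set r := (1 + D * A⁻¹ * p) / t with hr_def
  have hrt' : r * t = 1 + D * A⁻¹ * p := div_mul_cancel₀ _ ht0.ne'
  set β := lam * (1 - D * p / t) with hβ_def
  have hβx : β * (t / lam) = t - D * p := by
    rw [hβ_def]
    field_simp
  have hx : 0 < t / lam := by positivity
  have hβ0 : 0 < β := pos_of_mul_pos_left (by rw [hβx]; linarith) hx.le
  have hcount : ∀ X ⊆ SFTspace T, ∀ m : ℕ,
      (wordCount X (m + 1) : ℝ) ≤ max 1 (D * headWeight lam v [] / v i₀) * lam ^ (m + 1) :=
    fun X hX m => calc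
      (wordCount X (m + 1) : ℝ) ≤ ((freeWords T ∅ (m + 1)).card : ℝ) :=
        Nat.cast_le.2 (wordCount_le_card hX _)
      _ ≤ D * headWeight lam v [] / v i₀ * lam ^ (m + 1) :=
        card_freeWords_le hT01 hlam0 hv hTv hD i₀ m
      _ ≤ _ := by gcongr; exact le_max_right _ _
  have hup : entropy (SFTspace T) ≤ Real.log lam :=
    entropy_le_log hlam.le (le_max_left _ _) (hcount _ subset_rfl)
  have hlow : Real.log β ≤ entropy (Avoid T S) := by
    refine log_le_entropy hlam.le (le_max_left _ _) (hcount _ fun x hx => hx.1) hβ0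
      fun m hm => pow_le_wordCount_avoid (D := D) hβ0 (fun m => ?_) hm
    refine le_card_freeWords hT01 hlam0 hv hTv hD hSne i₀ hx (by rw [hβx]; linarith) ?_ m
    rw [hβx, ← hp, mul_div_cancel₀ _ hlam0.ne']
    linarith
  have hlt : Real.log lam + Real.log (1 - r) < Real.log β := by
    rw [← Real.log_mul hlam0.ne' (by linarith)]
    refine Real.log_lt_log (mul_pos hlam0 (by linarith)) ?_
    refine mul_lt_mul_of_pos_left (sub_lt_sub_left ?_ 1) hlam0
    rw [div_lt_iff₀ ht0, hrt']
    linarith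
  linarith

end SFT
end
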